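/- arXiv:1711.01655 — 4 statements merged into one kernel-verified Lean document; each statement's English description precedes it below -/
import Mathlib

section
/- Let n ≥ 1, Δ > 0 and ε > 0. Let J be a real symmetric n×n matrix which is Δ-dense, and let D be any real n×n matrix such that ‖J − D‖_{∞→1} ≤ 4εn‖J⃗‖_2. Set Z := Σ_{x∈{−1,1}^n} exp(xᵀJx) and Z' := Σ_{x∈{−1,1}^n} exp(xᵀDx). Then |log Z − log Z'| ≤ (4ε/√Δ)·‖J⃗‖_1. -/
open Real Finset

/-- The ±1 vector corresponding to a Boolean vector. -/
noncomputable def sv {n : ℕ} (x : Fin n → Bool) : Fin n → ℝ := fun i => if x i then 1 else -1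

/-- The quadratic form `xᵀ M x = ∑_{i,j} M_{ij} x_i x_j`. -/
def quad {n : ℕ} (M : Matrix (Fin n) (Fin n) ℝ) (x : Fin n → ℝ) : ℝ :=
  ∑ i, ∑ j, M i j * x i * x j

/-- The Ising partition function `Z = ∑_{x ∈ {−1,1}^n} exp(xᵀ M x)`. -/
noncomputable def partZ {n : ℕ} (M : Matrix (Fin n) (Fin n) ℝ) : ℝ :=
  ∑ x : Fin n → Bool, Real.exp (quad M (sv x))

/-- `‖M⃗‖₁ = ∑_{i,j} |M_{ij}|`. -/
noncomputable def vecNorm1 {n : ℕ} (M : Matrix (Fin n) (Fin n) ℝ) : ℝ := ∑ i, ∑ j, |M i j|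

/-- `‖M⃗‖₂ = (∑_{i,j} M_{ij}²)^{1/2}`. -/
noncomputable def vecNorm2 {n : ℕ} (M : Matrix (Fin n) (Fin n) ℝ) : ℝ :=
  Real.sqrt (∑ i, ∑ j, (M i j) ^ 2)

/-- `‖M⃗‖_∞ = max_{i,j} |M_{ij}|`. -/
noncomputable def vecNormInf {n : ℕ} (M : Matrix (Fin n) (Fin n) ℝ) : ℝ :=
  ⨆ p : Fin n × Fin n, |M p.1 p.2|

/-- `‖M‖_{∞→1} = sup_{‖x‖_∞ ≤ 1} ‖Mx‖₁`. -/
noncomputable def normInfTo1 {n : ℕ} (M : Matrix (Fin n) (Fin n) ℝ) : ℝ :=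
  ⨆ x : {x : Fin n → ℝ // ∀ i, |x i| ≤ 1}, ∑ i, |∑ j, M i j * x.1 j|

theorem abs_sv {n : ℕ} (x : Fin n → Bool) (i : Fin n) : |sv x i| = 1 := by
  unfold sv
  split_ifs <;> simp

theorem quad_sub {n : ℕ} (M N : Matrix (Fin n) (Fin n) ℝ) (x : Fin n → ℝ) :
    quad (M - N) x = quad M x - quad N x := by
  simp only [quad, Matrix.sub_apply, sub_mul, Finset.sum_sub_distrib]

theorem bddAbove_normInfTo1 {n : ℕ} (M : Matrix (Fin n) (Fin n) ℝ) :
    BddAbove (Set.range fun x : {x : Fin n → ℝ // ∀ i, |x i| ≤ 1} =>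
      ∑ i, |∑ j, M i j * x.1 j|) := by
  refine ⟨vecNorm1 M, ?_⟩
  rintro _ ⟨x, rfl⟩
  refine Finset.sum_le_sum fun i _ => (Finset.abs_sum_le_sum_abs _ _).trans ?_
  refine Finset.sum_le_sum fun j _ => ?_
  rw [abs_mul]
  exact mul_le_of_le_one_right (abs_nonneg _) (x.2 j)

theorem abs_quad_sv_le {n : ℕ} (M : Matrix (Fin n) (Fin n) ℝ) (x : Fin n → Bool) :
    |quad M (sv x)| ≤ normInfTo1 M := by
  have hsup : ∑ i, |∑ j, M i j * sv x j| ≤ normInfTo1 M :=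
    le_ciSup (bddAbove_normInfTo1 M) ⟨sv x, fun i => (abs_sv x i).le⟩
  refine le_trans ((Finset.abs_sum_le_sum_abs _ _).trans ?_) hsup
  refine Finset.sum_le_sum fun i _ => le_of_eq ?_
  have h : ∑ j, M i j * sv x i * sv x j = sv x i * ∑ j, M i j * sv x j := by
    rw [Finset.mul_sum]
    exact Finset.sum_congr rfl fun j _ => by ring
  rw [h, abs_mul, abs_sv, one_mul]

theorem partZ_pos {n : ℕ} (M : Matrix (Fin n) (Fin n) ℝ) : 0 < partZ M :=
  Finset.sum_pos (fun _ _ => Real.exp_pos _) Finset.univ_nonempty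

theorem log_partZ_le {n : ℕ} (M N : Matrix (Fin n) (Fin n) ℝ) (C : ℝ)
    (h : ∀ x : Fin n → Bool, quad M (sv x) ≤ C + quad N (sv x)) :
    Real.log (partZ M) ≤ C + Real.log (partZ N) := by
  have hle : partZ M ≤ Real.exp C * partZ N := by
    unfold partZ
    rw [Finset.mul_sum]
    refine Finset.sum_le_sum fun x _ => ?_
    rw [← Real.exp_add]
    exact Real.exp_le_exp.2 (h x)
  calc Real.log (partZ M) ≤ Real.log (Real.exp C * partZ N) := Real.log_le_log (partZ_pos M) hle
    _ = C + Real.log (partZ N) := by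
      rw [Real.log_mul (Real.exp_pos C).ne' (partZ_pos N).ne', Real.log_exp]

theorem abs_log_partZ_sub_le {n : ℕ} (M N : Matrix (Fin n) (Fin n) ℝ) :
    |Real.log (partZ M) - Real.log (partZ N)| ≤ normInfTo1 (M - N) := by
  have h (x : Fin n → Bool) := abs_le.1 (quad_sub M N (sv x) ▸ abs_quad_sv_le (M - N) x)
  have h₁ := log_partZ_le M N (normInfTo1 (M - N)) fun x => by linarith [(h x).2]
  have h₂ := log_partZ_le N M (normInfTo1 (M - N)) fun x => by linarith [(h x).1]
  exact abs_le.2 ⟨by linarith, by linarith⟩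

theorem sum_sq_le_vecNormInf_mul_vecNorm1 {n : ℕ} (M : Matrix (Fin n) (Fin n) ℝ) :
    ∑ i, ∑ j, (M i j) ^ 2 ≤ vecNormInf M * vecNorm1 M := by
  unfold vecNorm1
  simp only [Finset.mul_sum]
  refine Finset.sum_le_sum fun i _ => Finset.sum_le_sum fun j _ => ?_
  rw [← sq_abs, sq]
  refine mul_le_mul_of_nonneg_right ?_ (abs_nonneg _)
  exact le_ciSup (f := fun p : Fin n × Fin n => |M p.1 p.2|) (Set.finite_range _).bddAbove (i, j)

theorem vecNorm1_nonneg {n : ℕ} (M : Matrix (Fin n) (Fin n) ℝ) : 0 ≤ vecNorm1 M :=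
  Finset.sum_nonneg fun _ _ => Finset.sum_nonneg fun _ _ => abs_nonneg _

theorem mul_vecNorm2_le_of_dense {n : ℕ} (hn : 1 ≤ n) {Δ : ℝ} (hΔ : 0 < Δ)
    (M : Matrix (Fin n) (Fin n) ℝ) (hdense : Δ * vecNormInf M ≤ vecNorm1 M / (n : ℝ) ^ 2) :
    (n : ℝ) * vecNorm2 M ≤ vecNorm1 M / Real.sqrt Δ := by
  have hn' : (0 : ℝ) < n := by exact_mod_cast hn
  have h1 := vecNorm1_nonneg M
  have hinf : vecNormInf M * (Δ * (n : ℝ) ^ 2) ≤ vecNorm1 M := by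
    rw [le_div_iff₀ (by positivity)] at hdense
    linarith
  have hs : vecNorm2 M ≤ vecNorm1 M / (Real.sqrt Δ * n) := by
    refine Real.sqrt_le_iff.2 ⟨by positivity, ?_⟩
    rw [div_pow, mul_pow, Real.sq_sqrt hΔ.le, le_div_iff₀ (by positivity)]
    calc (∑ i, ∑ j, (M i j) ^ 2) * (Δ * (n : ℝ) ^ 2)
        ≤ vecNormInf M * vecNorm1 M * (Δ * (n : ℝ) ^ 2) :=
          mul_le_mul_of_nonneg_right (sum_sq_le_vecNormInf_mul_vecNorm1 M) (by positivity)
      _ = vecNormInf M * (Δ * (n : ℝ) ^ 2) * vecNorm1 M := by ring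
      _ ≤ vecNorm1 M * vecNorm1 M := mul_le_mul_of_nonneg_right hinf h1
      _ = vecNorm1 M ^ 2 := (sq _).symm
  calc (n : ℝ) * vecNorm2 M ≤ n * (vecNorm1 M / (Real.sqrt Δ * n)) :=
        mul_le_mul_of_nonneg_left hs hn'.le
    _ = vecNorm1 M / Real.sqrt Δ := by field_simp

theorem stmt0 (n : ℕ) (hn : 1 ≤ n) (Δ ε : ℝ) (hΔ : 0 < Δ) (hε : 0 < ε)
    (J D : Matrix (Fin n) (Fin n) ℝ) (hsym : J.IsSymm)
    (hdense : Δ * vecNormInf J ≤ vecNorm1 J / (n : ℝ) ^ 2)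
    (hD : normInfTo1 (J - D) ≤ 4 * ε * n * vecNorm2 J) :
    |Real.log (partZ J) - Real.log (partZ D)| ≤ (4 * ε / Real.sqrt Δ) * vecNorm1 J := by
  calc |Real.log (partZ J) - Real.log (partZ D)| ≤ normInfTo1 (J - D) := abs_log_partZ_sub_le J D
    _ ≤ 4 * ε * n * vecNorm2 J := hD
    _ = 4 * ε * (n * vecNorm2 J) := by ring
    _ ≤ 4 * ε * (vecNorm1 J / Real.sqrt Δ) :=
      mul_le_mul_of_nonneg_left (mul_vecNorm2_le_of_dense hn hΔ J hdense) (by positivity)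
    _ = (4 * ε / Real.sqrt Δ) * vecNorm1 J := by ring
end

section
/- Let D^{(i)} = CUT(R_i, C_i, d_i) for i = 1,…,s be cut matrices on {1,…,n}, and let V_1,…,V_r be a partition of {1,…,n} such that each R_i and each C_i is a union of some of the atoms V_a. For y = (y_1,…,y_r) with y_a ∈ {0,…,|V_a|}, set r'(y)_i := Σ_{a : V_a ⊆ R_i} (2y_a − |V_a|) and c'(y)_i := Σ_{a : V_a ⊆ C_i} (2y_a − |V_a|). Then Σ_{x∈{−1,1}^n} exp(xᵀ(D^{(1)}+⋯+D^{(s)})x) = Σ_y exp(Σ_{i=1}^s r'(y)_i c'(y)_i d_i) · Π_{a=1}^r C(|V_a|, y_a), where y ranges over Π_{a=1}^r {0,…,|V_a|}. -/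
open Real Finset

/-- The cut matrix `CUT(R, C, d)`: entry `(i,j)` equals `d` if `(i,j) ∈ R × C` and `0` otherwise. -/
def cutMatrix {n : ℕ} (R C : Finset (Fin n)) (d : ℝ) : Matrix (Fin n) (Fin n) ℝ :=
  fun i j => if i ∈ R ∧ j ∈ C then d else 0

/-- `r'(y)ᵢ = ∑_{a : V_a ⊆ R_i} (2 y_a − |V_a|)`, the net spin in `R_i` for the profile `y`. -/
noncomputable def netSpin {n r s : ℕ} (V : Fin r → Finset (Fin n)) (R : Fin s → Finset (Fin n))
    (y : Fin r → ℕ) (i : Fin s) : ℝ :=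
  ∑ a ∈ Finset.univ.filter (fun a => V a ⊆ R i), (2 * (y a : ℝ) - (V a).card)

/-- The number of coordinates in each part of `V` on which `x` is `true`. -/
def trueCount {n r : ℕ} (V : Fin r → Finset (Fin n)) (x : Fin n → Bool) (a : Fin r) : ℕ :=
  #{i ∈ V a | x i = true}

theorem sum_sv_eq {n : ℕ} (S : Finset (Fin n)) (x : Fin n → Bool) :
    ∑ i ∈ S, sv x i = 2 * (#{i ∈ S | x i = true} : ℝ) - #S := by
  have h : ∀ i, sv x i = 2 * (if x i = true then 1 else 0) - 1 := by
    intro i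
    unfold sv
    split_ifs <;> norm_num
  simp only [h, sum_sub_distrib, ← mul_sum, sum_boole, sum_const, nsmul_eq_mul, mul_one]

theorem netSpin_trueCount {n r s : ℕ} (V : Fin r → Finset (Fin n)) (R : Fin s → Finset (Fin n))
    (hdisj : ∀ a b, a ≠ b → Disjoint (V a) (V b))
    (hR : ∀ i, ∃ S : Finset (Fin r), R i = S.biUnion V) (x : Fin n → Bool) (i : Fin s) :
    netSpin V R (trueCount V x) i = ∑ j ∈ R i, sv x j := by
  have hu : R i = (univ.filter (fun a => V a ⊆ R i)).biUnion V := by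
    obtain ⟨S, hS⟩ := hR i
    apply Subset.antisymm
    · intro j hj
      obtain ⟨a, ha, hja⟩ := mem_biUnion.1 (hS ▸ hj)
      refine mem_biUnion.2 ⟨a, mem_filter.2 ⟨mem_univ a, ?_⟩, hja⟩
      rw [hS]
      exact subset_biUnion_of_mem V ha
    · exact biUnion_subset.2 fun a ha => (mem_filter.1 ha).2
  conv_rhs => rw [hu]
  rw [sum_biUnion fun a _ b _ hab => hdisj a b hab]
  exact sum_congr rfl fun a _ => (sum_sv_eq (V a) x).symm

theorem quad_sum_cutMatrix {n s : ℕ} (R C : Fin s → Finset (Fin n)) (d : Fin s → ℝ)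
    (x : Fin n → ℝ) :
    quad (∑ i, cutMatrix (R i) (C i) (d i)) x
      = ∑ i, (∑ j ∈ R i, x j) * (∑ j ∈ C i, x j) * d i := by
  have hcut : ∀ i, (∑ j ∈ R i, x j) * (∑ j ∈ C i, x j) * d i
      = ∑ j, ∑ k, cutMatrix (R i) (C i) (d i) j k * x j * x k := by
    intro i
    have hind : ∀ j k, cutMatrix (R i) (C i) (d i) j k * x j * x k
        = (if j ∈ R i then x j else 0) * (if k ∈ C i then x k else 0) * d i := by
      intro j k
      unfold cutMatrix
      by_cases hj : j ∈ R i <;> by_cases hk : k ∈ C i <;> simp [hj, hk]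
      ring
    simp only [hind, ← sum_mul, ← mul_sum, sum_ite_mem, univ_inter]
  rw [sum_congr rfl fun i _ => hcut i, sum_comm]
  refine sum_congr rfl fun j _ => ?_
  rw [sum_comm]
  simp only [Matrix.sum_apply, sum_mul]

theorem card_filter_trueCount_eq {n r : ℕ} (V : Fin r → Finset (Fin n))
    (hdisj : ∀ a b, a ≠ b → Disjoint (V a) (V b)) (hcover : ∀ i : Fin n, ∃ a, i ∈ V a)
    (y : Fin r → ℕ) :
    #{x : Fin n → Bool | trueCount V x = y} = ∏ a, (#(V a)).choose (y a) := by
  have hpart : ∀ f ∈ Fintype.piFinset (fun a => powersetCard (y a) (V a)), ∀ a,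
      {i ∈ V a | decide (∃ b, i ∈ f b) = true} = f a := by
    intro f hf a
    have hsub : ∀ b, f b ⊆ V b := fun b =>
      (mem_powersetCard.1 (Fintype.mem_piFinset.1 hf b)).1
    ext i
    simp only [mem_filter, decide_eq_true_eq]
    constructor
    · rintro ⟨hi, b, hb⟩
      by_cases hab : a = b
      · exact hab ▸ hb
      · exact absurd (hsub b hb) (disjoint_left.1 (hdisj a b hab) hi)
    · exact fun hi => ⟨hsub a hi, a, hi⟩
  simp only [← card_powersetCard]
  rw [← Fintype.card_piFinset]
  refine card_bij' (fun x _ a => {i ∈ V a | x i = true})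
    (fun f _ i => decide (∃ a, i ∈ f a)) ?_ ?_ ?_ ?_
  · intro x hx
    rw [Fintype.mem_piFinset]
    exact fun a => mem_powersetCard.2 ⟨filter_subset _ _, congrFun (mem_filter.1 hx).2 a⟩
  · intro f hf
    refine mem_filter.2 ⟨mem_univ _, funext fun a => ?_⟩
    rw [trueCount, hpart f hf a]
    exact (mem_powersetCard.1 (Fintype.mem_piFinset.1 hf a)).2
  · intro x _
    funext i
    obtain ⟨a, ha⟩ := hcover i
    rw [Bool.eq_iff_iff, decide_eq_true_eq]
    constructor
    · rintro ⟨b, hb⟩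
      exact (mem_filter.1 hb).2
    · exact fun hi => ⟨a, mem_filter.2 ⟨ha, hi⟩⟩
  · exact fun f hf => funext (hpart f hf)

theorem stmt5 (n s r : ℕ) (R C : Fin s → Finset (Fin n)) (d : Fin s → ℝ)
    (V : Fin r → Finset (Fin n))
    (hdisj : ∀ a b, a ≠ b → Disjoint (V a) (V b))
    (hcover : ∀ i : Fin n, ∃ a, i ∈ V a)
    (hR : ∀ i, ∃ S : Finset (Fin r), R i = S.biUnion V)
    (hC : ∀ i, ∃ S : Finset (Fin r), C i = S.biUnion V) :
    ∑ x : Fin n → Bool, Real.exp (quad (∑ i, cutMatrix (R i) (C i) (d i)) (sv x))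
      = ∑ y ∈ Fintype.piFinset (fun a => Finset.range ((V a).card + 1)),
          Real.exp (∑ i, netSpin V R y i * netSpin V C y i * d i) *
            ∏ a, ((V a).card.choose (y a) : ℝ) := by
  have hmaps : ∀ x ∈ (univ : Finset (Fin n → Bool)),
      trueCount V x ∈ Fintype.piFinset (fun a => Finset.range ((V a).card + 1)) := fun x _ =>
    Fintype.mem_piFinset.2 fun a => mem_range_succ_iff.2 (card_filter_le _ _)
  rw [← sum_fiberwise_of_maps_to hmaps]
  refine sum_congr rfl fun y _ => ?_
  rw [← Nat.cast_prod, ← card_filter_trueCount_eq V hdisj hcover y, mul_comm, ← nsmul_eq_mul]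
  refine sum_eq_card_nsmul fun x hx => ?_
  rw [← (mem_filter.1 hx).2, quad_sum_cutMatrix]
  simp only [netSpin_trueCount V R hdisj hR, netSpin_trueCount V C hdisj hC]
end

section
/- Let n ≥ 1 be a natural number and let z be a real number with 0 ≤ z ≤ n. Define y := ⌈z⌉ if z ≤ n/2 and y := ⌊z⌋ if z > n/2. Then n·H(y/n) ≥ n·H(z/n) − log 5. -/
open Real Finset

/-- The binary entropy function `H(p) = −p log p − (1−p) log(1−p)` (with `H(0) = H(1) = 0`,
since `Real.log 0 = 0`). -/
noncomputable def binH (p : ℝ) : ℝ := -p * Real.log p - (1 - p) * Real.log (1 - p)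

theorem binH_eq_binEntropy (p : ℝ) : binH p = binEntropy p := by
  simp only [binH, binEntropy, Real.log_inv]
  ring

theorem log_two_sub_sq_le_binEntropy {p : ℝ} (h0 : 0 ≤ p) (h1 : p ≤ 1) :
    Real.log 2 - (1 - 2 * p) ^ 2 ≤ binEntropy p := by
  have key : ∀ q : ℝ, 0 ≤ q → q * (Real.log 2 + Real.log q) ≤ q * (2 * q - 1) := by
    intro q hq
    rcases hq.eq_or_lt with rfl | hq
    · simp
    · rw [← Real.log_mul two_ne_zero hq.ne']
      exact mul_le_mul_of_nonneg_left (Real.log_le_sub_one_of_pos (by positivity)) hq.le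
  have hp := key p h0
  have hq := key (1 - p) (by linarith)
  simp only [binEntropy, Real.log_inv]
  nlinarith

theorem mul_binEntropy_sub_log_five_le_of_le_half {n : ℕ} (hn : 1 ≤ n) {z : ℝ} (hz0 : 0 ≤ z)
    (hz : z ≤ (n : ℝ) / 2) {k : ℤ} (hzk : z ≤ k) (hkz : (k : ℝ) < z + 1) :
    (n : ℝ) * binEntropy (z / n) - Real.log 5 ≤ (n : ℝ) * binEntropy (k / n) := by
  have hn1 : (1 : ℝ) ≤ n := by exact_mod_cast hn
  have hn0 : (0 : ℝ) < n := by linarith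
  have hlog : (1 : ℝ) ≤ Real.log 5 := by
    rw [Real.le_log_iff_exp_le (by norm_num)]
    linarith [Real.exp_one_lt_d9]
  by_cases hk : (k : ℝ) ≤ n / 2
  · have hmem : ∀ x : ℝ, 0 ≤ x → x ≤ n / 2 → x / n ∈ Set.Icc (0 : ℝ) 2⁻¹ := by
      intro x hx hxn
      refine ⟨by positivity, ?_⟩
      rw [div_le_iff₀ hn0]
      linarith
    have hmono := binEntropy_strictMonoOn.monotoneOn (hmem z hz0 hz)
      (hmem k (hz0.trans hzk) hk) (by gcongr)
    have := mul_le_mul_of_nonneg_left hmono hn0.le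
    linarith
  · push Not at hk
    have h2k : 2 * k = n + 1 := by
      have h1 : (n : ℤ) < 2 * k := by
        have : (n : ℝ) < 2 * k := by linarith
        exact_mod_cast this
      have h2 : 2 * k < (n : ℤ) + 2 := by
        have : 2 * (k : ℝ) < n + 2 := by linarith
        exact_mod_cast this
      omega
    have h2k' : 2 * (k : ℝ) = n + 1 := by exact_mod_cast h2k
    have hlow := log_two_sub_sq_le_binEntropy (p := (k : ℝ) / n)
      (div_nonneg (hz0.trans hzk) hn0.le) (by rw [div_le_one hn0]; linarith)
    have hsq : (n : ℝ) * (1 - 2 * ((k : ℝ) / n)) ^ 2 ≤ 1 := by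
      have : (n : ℝ) * (1 - 2 * ((k : ℝ) / n)) ^ 2 = 1 / n := by
        rw [← mul_div_assoc, h2k']
        field_simp
        ring
      rw [this, div_le_one hn0]
      exact hn1
    have hup := mul_le_mul_of_nonneg_left (binEntropy_le_log_two (p := z / n)) hn0.le
    have := mul_le_mul_of_nonneg_left hlow hn0.le
    linarith

theorem stmt10 (n : ℕ) (hn : 1 ≤ n) (z : ℝ) (hz0 : 0 ≤ z) (hzn : z ≤ n)
    (y : ℝ) (hy : y = if z ≤ (n : ℝ) / 2 then (⌈z⌉ : ℝ) else (⌊z⌋ : ℝ)) :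
    (n : ℝ) * binH (y / n) ≥ (n : ℝ) * binH (z / n) - Real.log 5 := by
  simp only [binH_eq_binEntropy, ge_iff_le]
  have hn0 : (n : ℝ) ≠ 0 := by positivity
  split_ifs at hy with hz
  · rw [hy]
    exact mul_binEntropy_sub_log_five_le_of_le_half hn hz0 hz (Int.le_ceil z)
      (Int.ceil_lt_add_one z)
  · have h := mul_binEntropy_sub_log_five_le_of_le_half hn (z := n - z) (k := n - ⌊z⌋)
      (by linarith) (by linarith) (by push_cast; linarith [Int.floor_le z])
      (by push_cast; linarith [Int.lt_floor_add_one z])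
    push_cast at h
    rwa [sub_div, sub_div, div_self hn0, binEntropy_one_sub, binEntropy_one_sub, ← hy] at h
end

section
/- Let J be a real symmetric n×n matrix which is regular with degree J' > 0, i.e. Σ_j |J_{ij}| = J' for every i, and suppose J is Δ-dense for some Δ > 0. Let J_D := J/J' and let λ_1,…,λ_n be the eigenvalues of the symmetric matrix J_D. Then for every δ > 0, the δ-sum-of-squares threshold rank satisfies Σ_{i : |λ_i| > δ} λ_i² ≤ Σ_{i=1}^n λ_i² = ‖J⃗_D‖_2² ≤ 1/Δ. -/
open Real Finset

/-- The squares of the eigenvalues of a real symmetric matrix sum to the sum of the squares of its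
entries. -/
theorem Matrix.IsHermitian.sum_eigenvalues_sq {ι : Type*} [Fintype ι] [DecidableEq ι]
    {A : Matrix ι ι ℝ} (hA : A.IsHermitian) :
    ∑ i, hA.eigenvalues i ^ 2 = ∑ i, ∑ j, A i j ^ 2 := by
  have htrace : (A * A).trace = ∑ i, hA.eigenvalues i ^ 2 := by
    conv_lhs => rw [hA.spectral_theorem, ← map_mul, Unitary.conjStarAlgAut_apply,
      Matrix.trace_mul_comm, ← mul_assoc, Unitary.coe_star_mul_self, one_mul,
      Matrix.diagonal_mul_diagonal, Matrix.trace_diagonal]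
    simp [sq]
  rw [← htrace]
  simp only [Matrix.trace, Matrix.diag_apply, Matrix.mul_apply]
  refine Finset.sum_congr rfl fun i _ => Finset.sum_congr rfl fun j _ => ?_
  rw [← hA.apply i j, star_trivial, sq]

theorem vecNorm2_sq {n : ℕ} (M : Matrix (Fin n) (Fin n) ℝ) :
    vecNorm2 M ^ 2 = ∑ i, ∑ j, M i j ^ 2 :=
  Real.sq_sqrt (by positivity)

theorem abs_le_vecNormInf {n : ℕ} (M : Matrix (Fin n) (Fin n) ℝ) (i j : Fin n) :
    |M i j| ≤ vecNormInf M :=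
  le_ciSup (f := fun p : Fin n × Fin n => |M p.1 p.2|) (Set.finite_range _).bddAbove (i, j)

theorem vecNorm2_sq_le {n : ℕ} (M : Matrix (Fin n) (Fin n) ℝ) :
    vecNorm2 M ^ 2 ≤ vecNormInf M * vecNorm1 M := by
  rw [vecNorm2_sq, vecNorm1]
  simp only [Finset.mul_sum]
  gcongr with i _ j _
  rw [← sq_abs, sq]
  gcongr
  exact abs_le_vecNormInf M i j

theorem vecNorm2_smul_sq {n : ℕ} (c : ℝ) (M : Matrix (Fin n) (Fin n) ℝ) :
    vecNorm2 (c • M) ^ 2 = c ^ 2 * vecNorm2 M ^ 2 := by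
  simp only [vecNorm2_sq, Matrix.smul_apply, smul_eq_mul, mul_pow, Finset.mul_sum]

theorem stmt19 (n : ℕ) (Δ J' : ℝ) (hΔ : 0 < Δ) (hJ' : 0 < J')
    (J : Matrix (Fin n) (Fin n) ℝ) (hsym : J.IsSymm)
    (hreg : ∀ i, ∑ j, |J i j| = J')
    (hdense : Δ * vecNormInf J ≤ vecNorm1 J / (n : ℝ) ^ 2)
    (JD : Matrix (Fin n) (Fin n) ℝ) (hJD : JD = (1 / J') • J)
    (hHerm : JD.IsHermitian) (δ : ℝ) (hδ : 0 < δ) :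
    (∑ i ∈ Finset.univ.filter (fun i => δ < |hHerm.eigenvalues i|),
        (hHerm.eigenvalues i) ^ 2) ≤ ∑ i, (hHerm.eigenvalues i) ^ 2 ∧
    (∑ i, (hHerm.eigenvalues i) ^ 2) = (vecNorm2 JD) ^ 2 ∧
    (vecNorm2 JD) ^ 2 ≤ 1 / Δ := by
  refine ⟨Finset.sum_le_sum_of_subset_of_nonneg (Finset.filter_subset _ _)
    fun i _ _ => sq_nonneg _, by rw [hHerm.sum_eigenvalues_sq, vecNorm2_sq], ?_⟩
  have hnorm1 : vecNorm1 J = n * J' := by simp [vecNorm1, hreg]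
  have key : Δ * vecNorm2 J ^ 2 ≤ J' ^ 2 := by
    calc Δ * vecNorm2 J ^ 2 ≤ Δ * vecNormInf J * vecNorm1 J := by
          rw [mul_assoc]
          gcongr
          exact vecNorm2_sq_le J
      _ ≤ vecNorm1 J / (n : ℝ) ^ 2 * vecNorm1 J := by
          gcongr
          rw [hnorm1]
          positivity
      _ = ((n : ℝ) / n) ^ 2 * J' ^ 2 := by rw [hnorm1]; ring
      _ ≤ 1 * J' ^ 2 := by
          gcongr
          exact pow_le_one₀ (by positivity) (div_self_le_one _)
      _ = J' ^ 2 := one_mul _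
  rw [hJD, vecNorm2_smul_sq, one_div_pow, one_div_mul_eq_div, div_le_div_iff₀ (by positivity) hΔ]
  linarith
end
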